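/- arXiv:2510.06727 — 4 statements merged into one kernel-verified Lean document; each statement's English description precedes it below -/
import Mathlib

section
/- For every t ≥ 1, the working context length satisfies |s_t| + |a_t| ≤ L + 2·L_A + L_O + |v_sum|. -/
/-- Under the summarization-augmented transition rule, for every `t ≥ 1`
the working context length satisfies `|s_t| + |a_t| ≤ L + 2·L_A + L_O + |v_sum|`. -/
theorem working_context_length_bound {V : Type*} (vsum : List V) (L LA LO : ℕ)
    (s a o : ℕ → List V)
    (hstep1 : ∀ t, 1 ≤ t → ¬ vsum.Sublist (s t) → (s t ++ a t ++ o t).length < L →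
      s (t + 1) = s t ++ a t ++ o t)
    (hstep2 : ∀ t, 1 ≤ t → ¬ vsum.Sublist (s t) → L ≤ (s t ++ a t ++ o t).length →
      s (t + 1) = s t ++ a t ++ o t ++ vsum)
    (hstep3 : ∀ t, 1 ≤ t → vsum.Sublist (s t) → s (t + 1) = s 1 ++ a t)
    (ha : ∀ t, 1 ≤ t → (a t).length ≤ LA)
    (ho : ∀ t, 1 ≤ t → (o t).length ≤ LO)
    (hinit : (s 1).length + LA ≤ L) :
    ∀ t, 1 ≤ t → (s t).length + (a t).length ≤ L + 2 * LA + LO + vsum.length := by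
  have bound : ∀ t, 1 ≤ t → (s t).length ≤ L + LA + LO + vsum.length ∧
      (¬ vsum.Sublist (s t) → (s t).length ≤ L) := by
    intro t ht
    induction t, ht using Nat.le_induction with
    | base => exact ⟨by omega, fun _ => by omega⟩
    | succ t ht ih =>
      have hat := ha t ht
      have hot := ho t ht
      by_cases hv : vsum.Sublist (s t)
      · rw [hstep3 t ht hv, List.length_append]
        exact ⟨by omega, fun _ => by omega⟩
      · have hst := ih.2 hv
        rcases lt_or_ge (s t ++ a t ++ o t).length L with hlt | hge
        · rw [hstep1 t ht hv hlt]
          exact ⟨by omega, fun _ => hlt.le⟩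
        · rw [hstep2 t ht hv hge]
          refine ⟨?_, fun h => absurd (List.sublist_append_right _ _) h⟩
          simp only [List.length_append]
          omega
  intro t ht
  have hst := (bound t ht).1
  have hat := ha t ht
  omega
end

section
/- For every t ≥ 1, if v_sum is not a sublist of s_t, then |s_t| ≤ L. (In particular, every state that does not contain the summarization prompt stays below the summarization threshold.) -/
/-- Under the summarization-augmented transition rule, every state `s_t`
(`t ≥ 1`) that does not contain the summarization prompt as a sublist has length at most
the summarization threshold `L`. -/
theorem state_length_below_threshold {V : Type*} (vsum : List V) (L LA : ℕ)
    (s a o : ℕ → List V)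
    (hstep1 : ∀ t, 1 ≤ t → ¬ vsum.Sublist (s t) → (s t ++ a t ++ o t).length < L →
      s (t + 1) = s t ++ a t ++ o t)
    (hstep2 : ∀ t, 1 ≤ t → ¬ vsum.Sublist (s t) → L ≤ (s t ++ a t ++ o t).length →
      s (t + 1) = s t ++ a t ++ o t ++ vsum)
    (hstep3 : ∀ t, 1 ≤ t → vsum.Sublist (s t) → s (t + 1) = s 1 ++ a t)
    (ha : ∀ t, 1 ≤ t → (a t).length ≤ LA)
    (hinit : (s 1).length + LA ≤ L) :
    ∀ t, 1 ≤ t → ¬ vsum.Sublist (s t) → (s t).length ≤ L := by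
  intro t ht hs
  induction t, ht using Nat.le_induction with
  | base => omega
  | succ t ht _ =>
    by_cases hsum : vsum.Sublist (s t)
    · have := ha t ht
      rw [hstep3 t ht hsum, List.length_append]
      omega
    · rcases lt_or_ge (s t ++ a t ++ o t).length L with hlt | hge
      · rw [hstep1 t ht hsum hlt]
        exact hlt.le
      · rw [hstep2 t ht hsum hge] at hs
        exact absurd (List.sublist_append_right _ _) hs
end

section
/- The map θ ↦ Σ_{ω ∈ Ω} p θ ω · R ω is differentiable at θ₀, and its Fréchet derivative at θ₀ equals Σ_{ω ∈ Ω} (p θ₀ ω · R ω) • D_θ (log (p θ ω))|_{θ=θ₀}, where D_θ (log (p θ ω))|_{θ=θ₀} denotes the Fréchet derivative at θ₀ of the map θ ↦ Real.log (p θ ω). (Score-function / log-derivative form of the gradient of an expectation over a finite sample space.) -/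
open scoped BigOperators

/-- (Score-function / log-derivative form of the gradient of an expectation
over a finite sample space.) The map `θ ↦ Σ_ω p θ ω * R ω` is differentiable at `θ₀` and its
Fréchet derivative there equals `Σ_ω (p θ₀ ω * R ω) • D_θ (log (p θ ω))|_{θ = θ₀}`. -/
theorem score_function_gradient {Ω : Type*} [Fintype Ω]
    {E : Type*} [NormedAddCommGroup E] [NormedSpace ℝ E]
    (θ₀ : E) (R : Ω → ℝ) (p : E → Ω → ℝ)
    (hdiff : ∀ ω, DifferentiableAt ℝ (fun θ => p θ ω) θ₀)
    (hpos : ∀ ω, 0 < p θ₀ ω) :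
    DifferentiableAt ℝ (fun θ => ∑ ω, p θ ω * R ω) θ₀ ∧
      fderiv ℝ (fun θ => ∑ ω, p θ ω * R ω) θ₀ =
        ∑ ω, (p θ₀ ω * R ω) • fderiv ℝ (fun θ => Real.log (p θ ω)) θ₀ := by
  have hsum : HasFDerivAt (fun θ => ∑ ω, p θ ω * R ω)
      (∑ ω, (p θ₀ ω * R ω) • fderiv ℝ (fun θ => Real.log (p θ ω)) θ₀) θ₀ := by
    refine HasFDerivAt.fun_sum fun ω _ => ?_
    have hp : p θ₀ ω ≠ 0 := (hpos ω).ne'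
    refine ((hdiff ω).hasFDerivAt.mul_const (R ω)).congr_fderiv ?_
    rw [fderiv.log (hdiff ω) hp, smul_smul]
    congr 1
    field_simp
  exact ⟨hsum.differentiableAt, hsum.fderiv⟩
end

section
/- The objective J : θ ↦ Σ_{τ ∈ (S×A)^H} P_θ(τ) · R s_H(τ) a_H(τ) is differentiable at θ₀, and its Fréchet derivative at θ₀ equals Σ_{τ ∈ (S×A)^H} (P_{θ₀}(τ) · R s_H(τ) a_H(τ)) • Σ_{h=1}^{H} D_θ (log (π θ s_h(τ) a_h(τ)))|_{θ=θ₀}, where D_θ (log (π θ s a))|_{θ=θ₀} denotes the Fréchet derivative at θ₀ of θ ↦ Real.log (π θ s a). (Policy gradient theorem for a finite-horizon MDP with finite state and action spaces.) -/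
open scoped BigOperators

/-- The probability weight of a length-`H` trajectory `τ = ((s_1,a_1),…,(s_H,a_H))`
(represented 0-indexed as `τ : Fin H → S × A`):
`P_θ(τ) = μ s_1 · (Π_{h=1}^{H-1} π θ s_h a_h · P s_h a_h s_{h+1}) · π θ s_H a_H`. -/
noncomputable def trajWeight {S A E : Type*} (H : ℕ) (hH : 0 < H)
    (μ : S → ℝ) (P : S → A → S → ℝ) (π : E → S → A → ℝ)
    (θ : E) (τ : Fin H → S × A) : ℝ :=
  μ (τ ⟨0, hH⟩).1 *
    (∏ h ∈ Finset.univ.filter (fun h : Fin H => (h : ℕ) + 1 < H),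
      π θ (τ h).1 (τ h).2 * P (τ h).1 (τ h).2 (τ ⟨((h : ℕ) + 1) % H, Nat.mod_lt _ hH⟩).1) *
    π θ (τ ⟨H - 1, Nat.sub_lt hH one_pos⟩).1 (τ ⟨H - 1, Nat.sub_lt hH one_pos⟩).2

/-- The trajectory weight is the product of the action probabilities along the trajectory, times a
factor that does not depend on the policy. -/
lemma trajWeight_eq_mul_prod {S A E : Type*} (H : ℕ) (hH : 0 < H)
    (μ : S → ℝ) (P : S → A → S → ℝ) (π : E → S → A → ℝ) (θ : E) (τ : Fin H → S × A) :
    trajWeight H hH μ P π θ τ =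
      (μ (τ ⟨0, hH⟩).1 * ∏ h ∈ Finset.univ.filter (fun h : Fin H => (h : ℕ) + 1 < H),
        P (τ h).1 (τ h).2 (τ ⟨((h : ℕ) + 1) % H, Nat.mod_lt _ hH⟩).1) *
      ∏ h : Fin H, π θ (τ h).1 (τ h).2 := by
  have last_step : Finset.univ.filter (fun h : Fin H => ¬ (h : ℕ) + 1 < H) =
      {⟨H - 1, Nat.sub_lt hH one_pos⟩} := by
    ext h
    simp only [Finset.mem_filter, Finset.mem_univ, true_and, Finset.mem_singleton, Fin.ext_iff]
    omega
  rw [trajWeight, ← Finset.prod_filter_mul_prod_filter_not Finset.univ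
    (fun h : Fin H => (h : ℕ) + 1 < H) (fun h => π θ (τ h).1 (τ h).2), last_step,
    Finset.prod_singleton, Finset.prod_mul_distrib]
  ring

/-- Logarithmic differentiation of a finite product of nonvanishing real functions. -/
lemma hasFDerivAt_prod_of_ne_zero {ι E : Type*} [NormedAddCommGroup E] [NormedSpace ℝ E]
    (u : Finset ι) {f : ι → E → ℝ} {x : E} (hf : ∀ i ∈ u, DifferentiableAt ℝ (f i) x)
    (hx : ∀ i ∈ u, f i x ≠ 0) :
    HasFDerivAt (fun y => ∏ i ∈ u, f i y)
      ((∏ i ∈ u, f i x) • ∑ i ∈ u, fderiv ℝ (fun y => Real.log (f i y)) x) x := by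
  classical
  refine (HasFDerivAt.finsetProd fun i hi => (hf i hi).hasFDerivAt).congr_fderiv ?_
  rw [Finset.smul_sum]
  refine Finset.sum_congr rfl fun i hi => ?_
  rw [fderiv.log (hf i hi) (hx i hi), smul_smul, ← Finset.prod_erase_mul u _ hi,
    mul_inv_cancel_right₀ (hx i hi)]

/-- The log-derivative identity for the weight of a single trajectory. -/
lemma hasFDerivAt_trajWeight {S A E : Type*} [NormedAddCommGroup E] [NormedSpace ℝ E]
    (H : ℕ) (hH : 0 < H) (μ : S → ℝ) (P : S → A → S → ℝ) (π : E → S → A → ℝ)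
    (τ : Fin H → S × A) {θ₀ : E}
    (hdiff : ∀ h, DifferentiableAt ℝ (fun θ => π θ (τ h).1 (τ h).2) θ₀)
    (hne : ∀ h, π θ₀ (τ h).1 (τ h).2 ≠ 0) :
    HasFDerivAt (fun θ => trajWeight H hH μ P π θ τ)
      (trajWeight H hH μ P π θ₀ τ •
        ∑ h : Fin H, fderiv ℝ (fun θ => Real.log (π θ (τ h).1 (τ h).2)) θ₀) θ₀ := by
  simp only [trajWeight_eq_mul_prod, mul_smul _ (∏ h : Fin H, π θ₀ (τ h).1 (τ h).2)]
  exact (hasFDerivAt_prod_of_ne_zero Finset.univ (fun h _ => hdiff h) fun h _ => hne h).const_mul _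

/-- (Policy gradient theorem for a finite-horizon MDP with finite state and
action spaces.) The objective `J : θ ↦ Σ_τ P_θ(τ) · R s_H(τ) a_H(τ)` is differentiable at
`θ₀`, and its Fréchet derivative at `θ₀` equals
`Σ_τ (P_{θ₀}(τ) · R s_H(τ) a_H(τ)) • Σ_{h=1}^{H} D_θ (log (π θ s_h(τ) a_h(τ)))|_{θ=θ₀}`. -/
theorem policy_gradient {S A : Type*} [Fintype S] [Fintype A]
    {E : Type*} [NormedAddCommGroup E] [NormedSpace ℝ E]
    (H : ℕ) (hH : 0 < H) (μ : S → ℝ) (P : S → A → S → ℝ) (R : S → A → ℝ)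
    (θ₀ : E) (π : E → S → A → ℝ)
    (hdiff : ∀ s a, DifferentiableAt ℝ (fun θ => π θ s a) θ₀)
    (hpos : ∀ s a, 0 < π θ₀ s a) :
    DifferentiableAt ℝ
      (fun θ => ∑ τ : Fin H → S × A, trajWeight H hH μ P π θ τ *
        R (τ ⟨H - 1, Nat.sub_lt hH one_pos⟩).1 (τ ⟨H - 1, Nat.sub_lt hH one_pos⟩).2) θ₀ ∧
    fderiv ℝ
      (fun θ => ∑ τ : Fin H → S × A, trajWeight H hH μ P π θ τ *
        R (τ ⟨H - 1, Nat.sub_lt hH one_pos⟩).1 (τ ⟨H - 1, Nat.sub_lt hH one_pos⟩).2) θ₀ =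
      ∑ τ : Fin H → S × A,
        (trajWeight H hH μ P π θ₀ τ *
            R (τ ⟨H - 1, Nat.sub_lt hH one_pos⟩).1 (τ ⟨H - 1, Nat.sub_lt hH one_pos⟩).2) •
          ∑ h : Fin H, fderiv ℝ (fun θ => Real.log (π θ (τ h).1 (τ h).2)) θ₀ := by
  have hJ := HasFDerivAt.fun_sum fun (τ : Fin H → S × A) (_ : τ ∈ Finset.univ) =>
    (hasFDerivAt_trajWeight H hH μ P π τ (fun h => hdiff (τ h).1 (τ h).2)
      (fun h => (hpos (τ h).1 (τ h).2).ne')).mul_const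
      (R (τ ⟨H - 1, Nat.sub_lt hH one_pos⟩).1 (τ ⟨H - 1, Nat.sub_lt hH one_pos⟩).2)
  refine ⟨hJ.differentiableAt, hJ.fderiv.trans (Finset.sum_congr rfl fun τ _ => ?_)⟩
  rw [smul_smul, mul_comm]
end
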